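/- Let T = (T₁, T₂) be a pair of commuting contractions on H. A positive operator N satisfies Tᵢ* N Tᵢ ≤ N (i = 1,2) and (T₁T₂)^{*k} N (T₁T₂)^k → 0 in SOT if and only if there exist a Hilbert space E, a bounded operator Π : H → H²_E(𝔻), a unitary U and orthogonal projection P on E, such that N = Π* Π and Π Tᵢ = M_{Φᵢ}* Π for i = 1,2, where Φ₁(z) = (P + zP^⊥)U*, Φ₂(z) = U(P^⊥ + zP). In this case Φ₁(z)Φ₂(z) = Φ₂(z)Φ₁(z) = z·I_E and M_{Φ₁}, M_{Φ₂} are commuting isometries. -/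

import Mathlib

open ContinuousLinearMap Filter Topology

section SquareSummableSequences

variable {X E : Type*} [NormedAddCommGroup X] [InnerProductSpace ℂ X]
  [NormedAddCommGroup E] [InnerProductSpace ℂ E]

omit [InnerProductSpace ℂ E] in
lemma lp.hasSum_norm_sq (f : lp (fun _ : ℕ => E) 2) : HasSum (fun k => ‖f k‖ ^ 2) (‖f‖ ^ 2) := by
  simpa using lp.hasSum_norm (p := 2) (by simp) f

/-- A sequence of linear maps into `E` whose square norms sum to a bounded quadratic form
assembles into a bounded operator into `ℓ²(ℕ, E)`. -/
lemma exists_clm_lp_of_hasSum (L : ℕ → X →ₗ[ℂ] E) (q : X → ℝ) (C : ℝ)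
    (hL : ∀ x, HasSum (fun k => ‖L k x‖ ^ 2) (q x)) (hq : ∀ x, q x ≤ C ^ 2 * ‖x‖ ^ 2) :
    ∃ S : X →L[ℂ] lp (fun _ : ℕ => E) 2, (∀ x k, S x k = L k x) ∧ ∀ x, ‖S x‖ ^ 2 = q x := by
  have hmem (x : X) : Memℓp (fun k => L k x) 2 := memℓp_gen (by simpa using (hL x).summable)
  let S₀ : X →ₗ[ℂ] lp (fun _ : ℕ => E) 2 :=
    { toFun := fun x => ⟨fun k => L k x, hmem x⟩
      map_add' := fun x y => by ext k; exact map_add (L k) x y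
      map_smul' := fun c x => by ext k; exact map_smul (L k) c x }
  have hS (x : X) : ‖S₀ x‖ ^ 2 = q x := (lp.hasSum_norm_sq (S₀ x)).unique (hL x)
  refine ⟨S₀.mkContinuous |C| fun x => ?_, fun _ _ => rfl, hS⟩
  refine abs_le_of_sq_le_sq' ?_ (by positivity) |>.2
  rw [hS, mul_pow, sq_abs]
  exact hq x

/-- `M` acts on `ℓ²(ℕ, E)` as multiplication by `A + z B` acts on Taylor coefficients. -/
structure HasLinearSymbol (M : lp (fun _ : ℕ => E) 2 →L[ℂ] lp (fun _ : ℕ => E) 2)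
    (A B : E →L[ℂ] E) : Prop where
  apply_zero : ∀ f, M f 0 = A (f 0)
  apply_succ : ∀ f (k : ℕ), M f (k + 1) = A (f (k + 1)) + B (f k)

lemma exists_isometric_hasLinearSymbol (A B : E →L[ℂ] E)
    (horth : ∀ x y, inner ℂ (A x) (B y) = 0) (hnorm : ∀ x, ‖A x‖ ^ 2 + ‖B x‖ ^ 2 = ‖x‖ ^ 2) :
    ∃ M, HasLinearSymbol M A B ∧ ∀ f, ‖M f‖ = ‖f‖ := by
  let ev (k : ℕ) : lp (fun _ : ℕ => E) 2 →ₗ[ℂ] E :=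
    { toFun := fun f => f k
      map_add' := fun _ _ => rfl
      map_smul' := fun _ _ => rfl }
  let L : ℕ → lp (fun _ : ℕ => E) 2 →ₗ[ℂ] E
    | 0 => A.toLinearMap ∘ₗ ev 0
    | k + 1 => A.toLinearMap ∘ₗ ev (k + 1) + B.toLinearMap ∘ₗ ev k
  have hL (f : lp (fun _ : ℕ => E) 2) : HasSum (fun k => ‖L k f‖ ^ 2) (‖f‖ ^ 2) := by
    have hf := lp.hasSum_norm_sq f
    have hA : Summable fun k => ‖A (f k)‖ ^ 2 := hf.summable.of_nonneg_of_le
      (fun k => by positivity) fun k => by nlinarith [hnorm (f k), sq_nonneg ‖B (f k)‖]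
    have hB : Summable fun k => ‖B (f k)‖ ^ 2 := hf.summable.of_nonneg_of_le
      (fun k => by positivity) fun k => by nlinarith [hnorm (f k), sq_nonneg ‖A (f k)‖]
    have hsum : ‖f‖ ^ 2 = ∑' k, ‖A (f k)‖ ^ 2 + ∑' k, ‖B (f k)‖ ^ 2 := by
      rw [← hA.tsum_add hB, ← hf.tsum_eq]
      simp only [hnorm]
    have hstep (k : ℕ) : ‖L (k + 1) f‖ ^ 2 = ‖A (f (k + 1))‖ ^ 2 + ‖B (f k)‖ ^ 2 := by
      have := norm_add_sq_eq_norm_sq_add_norm_sq_of_inner_eq_zero _ _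
        (horth (f (k + 1)) (f k))
      simp only [sq]
      exact this
    rw [← hasSum_nat_add_iff' 1]
    simp only [hstep, Finset.sum_range_one]
    have h0 : ‖L 0 f‖ ^ 2 = ‖A (f 0)‖ ^ 2 := rfl
    rw [hsum, h0, add_sub_right_comm]
    refine HasSum.add ?_ hB.hasSum
    simpa using (hasSum_nat_add_iff' 1).2 hA.hasSum
  obtain ⟨M, hM, hM'⟩ := exists_clm_lp_of_hasSum L (fun f => ‖f‖ ^ 2) 1 hL (by simp)
  refine ⟨M, ⟨fun f => hM f 0, fun f k => hM f (k + 1)⟩, fun f => ?_⟩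
  exact (sq_eq_sq₀ (norm_nonneg _) (norm_nonneg _)).1 (hM' f)

namespace HasLinearSymbol

variable {M M' : lp (fun _ : ℕ => E) 2 →L[ℂ] lp (fun _ : ℕ => E) 2} {A B A' B' : E →L[ℂ] E}

lemma ext (h : HasLinearSymbol M A B) (h' : HasLinearSymbol M' A B) : M = M' := by
  ext f k
  cases k with
  | zero => rw [h.apply_zero, h'.apply_zero]
  | succ k => rw [h.apply_succ, h'.apply_succ]

lemma comp_eq_shift (h : HasLinearSymbol M A B) (h' : HasLinearSymbol M' A' B')
    (hA : A ∘L A' = 0) (hB : B ∘L B' = 0) (hAB : A ∘L B' + B ∘L A' = 1) :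
    HasLinearSymbol (M ∘L M') 0 1 := by
  have hA (x : E) : A (A' x) = 0 := congr($hA x)
  have hB (x : E) : B (B' x) = 0 := congr($hB x)
  have hAB (x : E) : A (B' x) + B (A' x) = x := congr($hAB x)
  refine ⟨fun f => ?_, fun f k => ?_⟩
  · simp [h.apply_zero, h'.apply_zero, hA]
  · cases k with
    | zero => simp [h.apply_succ, h'.apply_succ, h'.apply_zero, hA, hAB]
    | succ k =>
      simp only [ContinuousLinearMap.comp_apply, h.apply_succ, h'.apply_succ, map_add, hA, hB]
      simp [hAB]

variable [CompleteSpace E]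

lemma adjoint_apply (h : HasLinearSymbol M A B) (f : lp (fun _ : ℕ => E) 2) (k : ℕ) :
    adjoint M f k = adjoint A (f k) + adjoint B (f (k + 1)) := by
  refine ext_inner_left ℂ fun v => ?_
  have hM : M (lp.single 2 k v) = lp.single 2 k (A v) + lp.single 2 (k + 1) (B v) := by
    ext j
    cases j with
    | zero =>
      rw [h.apply_zero]
      by_cases hk : k = 0
      · subst hk
        simp [lp.single_apply]
      · simp [lp.single_apply, Ne.symm hk]
    | succ j =>
      rw [h.apply_succ]
      simp only [lp.coeFn_add, Pi.add_apply, lp.single_apply, Pi.single_apply]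
      split_ifs <;> simp_all
  rw [← lp.inner_single_left (𝕜 := ℂ) (G := fun _ : ℕ => E),
    ContinuousLinearMap.adjoint_inner_right, hM,
    inner_add_left, lp.inner_single_left, lp.inner_single_left, inner_add_right,
    ContinuousLinearMap.adjoint_inner_right, ContinuousLinearMap.adjoint_inner_right]

lemma tendsto_adjoint_pow (h : HasLinearSymbol M 0 1) (f : lp (fun _ : ℕ => E) 2) :
    Tendsto (fun n : ℕ => (adjoint M ^ n) f) atTop (𝓝 0) := by
  have hcoord (n k : ℕ) : (adjoint M ^ n) f k = f (k + n) := by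
    induction n generalizing k with
    | zero => simp
    | succ n ih =>
      have h1 : adjoint (1 : E →L[ℂ] E) = 1 := star_one _
      rw [pow_succ', mul_apply_eq_comp, h.adjoint_apply, ih, ih, map_zero, h1,
        add_assoc, add_comm 1 n]
      simp
  have hsq : Tendsto (fun n : ℕ => ‖(adjoint M ^ n) f‖ ^ 2) atTop (𝓝 0) := by
    refine (tendsto_sum_nat_add fun k => ‖f k‖ ^ 2).congr fun n => ?_
    rw [← (lp.hasSum_norm_sq ((adjoint M ^ n) f)).tsum_eq]
    simp only [hcoord]
  rw [tendsto_zero_iff_norm_tendsto_zero]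
  simpa using hsq.sqrt

end HasLinearSymbol

end SquareSummableSequences

section Factorization

variable {H E : Type*} [NormedAddCommGroup H] [InnerProductSpace ℂ H] [CompleteSpace H]
  [NormedAddCommGroup E] [InnerProductSpace ℂ E] [CompleteSpace E]

lemma ContinuousLinearMap.IsPositive.exists_norm_sq_eq {A : H →L[ℂ] H} (hA : A.IsPositive) :
    ∃ D : H →L[ℂ] H, ∀ h, ‖D h‖ ^ 2 = (inner ℂ (A h) h).re := by
  obtain ⟨D, hD⟩ := CStarAlgebra.nonneg_iff_eq_star_mul_self.1 ((nonneg_iff_isPositive A).2 hA)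
  refine ⟨D, fun h => ?_⟩
  rw [hD, ContinuousLinearMap.star_eq_adjoint, mul_apply_eq_comp, adjoint_inner_left]
  exact norm_sq_eq_re_inner (𝕜 := ℂ) _

lemma ContinuousLinearMap.IsPositive.eq_adjoint_comp_self {N : H →L[ℂ] H} (hN : N.IsPositive)
    (S : H →L[ℂ] E) (h : ∀ x, ‖S x‖ ^ 2 = (inner ℂ (N x) x).re) : N = adjoint S ∘L S := by
  refine ContinuousLinearMap.coe_injective ((ext_inner_map _ _).1 fun x => ?_)
  have h1 := hN.inner_nonneg_left x
  have h2 := (isPositive_adjoint_comp_self S).inner_nonneg_left x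
  refine Complex.ext ?_ ?_
  · refine (h x).symm.trans ?_
    simp only [ContinuousLinearMap.coe_coe, ContinuousLinearMap.comp_apply, adjoint_inner_left]
    exact norm_sq_eq_re_inner (𝕜 := ℂ) _
  · exact (Complex.le_def.1 h1).2.symm.trans (Complex.le_def.1 h2).2

/-- Telescoping the defect form `N - T* N T = G* G` gives `N = S* S` where `S h` is the
sequence `(G T ^ k h)_k`. -/
lemma exists_factorization_of_defect {N T : H →L[ℂ] H} (hN : N.IsPositive) (G : H →L[ℂ] E)
    (hG : ∀ h, ‖G h‖ ^ 2 = (inner ℂ (N h) h).re - (inner ℂ (N (T h)) (T h)).re)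
    (hlim : ∀ h, Tendsto (fun k : ℕ => (inner ℂ (N ((T ^ k) h)) ((T ^ k) h)).re) atTop (𝓝 0)) :
    ∃ S : H →L[ℂ] lp (fun _ : ℕ => E) 2,
      (∀ h k, S h k = G ((T ^ k) h)) ∧ N = adjoint S ∘L S := by
  obtain ⟨D, hD⟩ := hN.exists_norm_sq_eq
  have hsum (h : H) : HasSum (fun k : ℕ => ‖G ((T ^ k) h)‖ ^ 2) (inner ℂ (N h) h).re := by
    rw [hasSum_iff_tendsto_nat_of_nonneg fun k => by positivity]
    have htel (n : ℕ) : ∑ k ∈ Finset.range n, ‖G ((T ^ k) h)‖ ^ 2 =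
        (inner ℂ (N h) h).re - (inner ℂ (N ((T ^ n) h)) ((T ^ n) h)).re := by
      induction n with
      | zero => simp
      | succ n ih =>
        rw [Finset.sum_range_succ, ih, hG, pow_succ', mul_apply_eq_comp]
        ring
    simp only [htel]
    simpa using (hlim h).const_sub (inner ℂ (N h) h).re
  obtain ⟨S, hS, hS'⟩ := exists_clm_lp_of_hasSum
    (fun k => (G ∘L T ^ k).toLinearMap) (fun h => (inner ℂ (N h) h).re) ‖D‖ hsum fun h => by
      rw [← hD, ← mul_pow]
      gcongr
      exact D.le_opNorm h
  exact ⟨S, hS, hN.eq_adjoint_comp_self S hS'⟩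

/-- If `F` and `G` have equal Gram forms and an isometry `σ` moves the range of `G` to a space
orthogonal to the range of `F`, then `F h ↦ G h` extends to a unitary, namely `σ⁻¹` after the
reflection in the closure of `{F h + σ (G h)}`. -/
lemma exists_unitary_apply_eq (σ : E ≃ₗᵢ[ℂ] E) (F G : H →L[ℂ] E) (hFG : ∀ h, ‖F h‖ = ‖G h‖)
    (horth : ∀ h k, inner ℂ (F h) (σ (G k)) = 0) :
    ∃ U : E ≃ₗᵢ[ℂ] E, ∀ h, U (F h) = G h := by
  let σG : H →L[ℂ] E := (σ : E →L[ℂ] E) ∘L G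
  have hgram (h k : H) : inner ℂ (F h) (F k) = inner ℂ (σ (G h)) (σ (G k)) := by
    rw [σ.inner_map_map]
    have : adjoint F ∘L F = adjoint G ∘L G :=
      (isPositive_adjoint_comp_self F).eq_adjoint_comp_self G fun x => by
        rw [← hFG, ContinuousLinearMap.comp_apply, adjoint_inner_left]
        exact norm_sq_eq_re_inner (𝕜 := ℂ) _
    simpa [adjoint_inner_left] using congr(inner ℂ ($this h) k)
  let R : Submodule ℂ E := (F + σG).range
  let K : Submodule ℂ E := R.topologicalClosure
  have hmem (h : H) : F h + σ (G h) ∈ K := R.le_topologicalClosure ⟨h, rfl⟩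
  have hperp (h : H) : F h - σ (G h) ∈ Kᗮ := by
    rw [Submodule.orthogonal_closure, Submodule.mem_orthogonal]
    rintro _ ⟨k, rfl⟩
    change inner ℂ (F k + σ (G k)) (F h - σ (G h)) = 0
    have : inner ℂ (σ (G k)) (F h) = 0 := inner_eq_zero_symm.1 (horth h k)
    rw [inner_add_left, inner_sub_right, inner_sub_right, horth, this, hgram]
    ring
  have : CompleteSpace K := R.isClosed_topologicalClosure.completeSpace_coe
  refine ⟨K.reflection.trans σ.symm, fun h => ?_⟩
  have h1 := K.reflection_mem_subspace_eq_self (hmem h)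
  have h2 := K.reflection_mem_subspace_orthogonalComplement_eq_neg (hperp h)
  rw [LinearIsometryEquiv.trans_apply, LinearIsometryEquiv.symm_apply_eq]
  rw [map_add] at h1
  rw [map_sub] at h2
  have h3 : (2 : ℂ) • K.reflection (F h) = (2 : ℂ) • σ (G h) := by
    calc (2 : ℂ) • K.reflection (F h)
        = (K.reflection (F h) + K.reflection (σ (G h))) +
          (K.reflection (F h) - K.reflection (σ (G h))) := by module
      _ = (F h + σ (G h)) + -(F h - σ (G h)) := by rw [h1, h2]
      _ = (2 : ℂ) • σ (G h) := by module
  exact smul_right_injective E two_ne_zero h3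

end Factorization

section BCLTriple

universe u

variable {H : Type u} [NormedAddCommGroup H] [InnerProductSpace ℂ H]

/-- Four orthogonal copies of `H`. The first index is cut down by `fourfoldProj`; the second
doubles the space, leaving room to extend partial isometries to unitaries. -/
abbrev Fourfold (H : Type u) : Type u := PiLp 2 fun _ : Bool × Bool => H

/-- The operator into `Fourfold H` with the given components. -/
noncomputable def fourfoldOfComponents {X : Type*} [NormedAddCommGroup X] [NormedSpace ℂ X]
    (L : Bool × Bool → X →L[ℂ] H) : X →L[ℂ] Fourfold H :=
  (PiLp.continuousLinearEquiv 2 ℂ fun _ : Bool × Bool => H).symm.toContinuousLinearMap ∘L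
    ContinuousLinearMap.pi L

@[simp]
lemma fourfoldOfComponents_apply {X : Type*} [NormedAddCommGroup X] [NormedSpace ℂ X]
    (L : Bool × Bool → X →L[ℂ] H) (x : X) (i : Bool × Bool) :
    fourfoldOfComponents L x i = L i x := rfl

/-- The operator `h ↦ (c h, d h)` into the part of `Fourfold H` of second index `true`. -/
noncomputable def fourfoldPair (c d : H →L[ℂ] H) : H →L[ℂ] Fourfold H :=
  fourfoldOfComponents fun i => if i.2 then if i.1 then c else d else 0

/-- The projection onto the components of first index `true`. -/
noncomputable def fourfoldProj : Fourfold H →L[ℂ] Fourfold H :=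
  fourfoldOfComponents fun i =>
    if i.1 then PiLp.proj (𝕜 := ℂ) 2 (fun _ : Bool × Bool => H) i else 0

lemma fourfoldPair_apply (c d : H →L[ℂ] H) (h : H) (i : Bool × Bool) :
    fourfoldPair c d h i = if i.2 then if i.1 then c h else d h else 0 := by
  unfold fourfoldPair
  rw [fourfoldOfComponents_apply]
  split_ifs <;> rfl

lemma fourfoldProj_apply (x : Fourfold H) (i : Bool × Bool) :
    fourfoldProj x i = if i.1 then x i else 0 := by
  unfold fourfoldProj
  rw [fourfoldOfComponents_apply]
  split_ifs <;> rfl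

lemma norm_fourfoldPair_sq (c d : H →L[ℂ] H) (h : H) :
    ‖fourfoldPair c d h‖ ^ 2 = ‖c h‖ ^ 2 + ‖d h‖ ^ 2 := by
  simp [PiLp.norm_sq_eq_of_L2, Fintype.sum_prod_type, fourfoldPair_apply]

lemma fourfoldProj_fourfoldPair (c d : H →L[ℂ] H) (h : H) :
    fourfoldProj (fourfoldPair c d h) = fourfoldPair c 0 h := by
  ext ⟨i, j⟩
  cases i <;> simp [fourfoldProj_apply, fourfoldPair_apply]

lemma one_sub_fourfoldProj_fourfoldPair (c d : H →L[ℂ] H) (h : H) :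
    (1 - fourfoldProj : Fourfold H →L[ℂ] Fourfold H) (fourfoldPair c d h) = fourfoldPair 0 d h := by
  ext ⟨i, j⟩
  cases i <;> simp [fourfoldProj_apply, fourfoldPair_apply]

variable [CompleteSpace H]

lemma isSelfAdjoint_fourfoldProj : IsSelfAdjoint (fourfoldProj : Fourfold H →L[ℂ] _) := by
  rw [isSelfAdjoint_iff_isSymmetric]
  intro x y
  simp [PiLp.inner_apply, Fintype.sum_prod_type, fourfoldProj_apply]

omit [CompleteSpace H] in
lemma isIdempotentElem_fourfoldProj : IsIdempotentElem (fourfoldProj : Fourfold H →L[ℂ] _) := by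
  ext x ⟨i, j⟩
  cases i <;> simp [fourfoldProj_apply]

/-- A BCL triple `(E, U, P)` with an operator `G` into `E` satisfying the coefficientwise
intertwining relations, built from a pair `a, b` of defect operators. -/
lemma exists_BCL_triple (T₁ T₂ a b : H →L[ℂ] H) (hcomm : Commute T₁ T₂)
    (hab : ∀ h, ‖a (T₁ h)‖ ^ 2 + ‖b h‖ ^ 2 = ‖a h‖ ^ 2 + ‖b (T₂ h)‖ ^ 2) :
    ∃ (E : Type u) (_ : NormedAddCommGroup E) (_ : InnerProductSpace ℂ E) (_ : CompleteSpace E)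
      (U : E ≃ₗᵢ[ℂ] E) (P : E →L[ℂ] E) (G : H →L[ℂ] E),
      IsSelfAdjoint P ∧ IsIdempotentElem P ∧
      (∀ h, ‖G h‖ ^ 2 = ‖a (T₁ h)‖ ^ 2 + ‖b h‖ ^ 2) ∧
      (∀ h, G (T₁ h) = U (P (G h)) + U ((1 - P) (G (T₁ (T₂ h))))) ∧
      (∀ h, G (T₂ h) = (1 - P) (U.symm (G h)) + P (U.symm (G (T₁ (T₂ h))))) := by
  obtain ⟨U, hU⟩ := exists_unitary_apply_eq (E := Fourfold H)
    (LinearIsometryEquiv.piLpCongrLeft 2 ℂ H ((Equiv.refl Bool).prodCongr Equiv.boolNot))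
    (fourfoldPair a (b ∘L T₂)) (fourfoldPair (a ∘L T₁) b)
    (fun h => by
      rw [← sq_eq_sq₀ (norm_nonneg _) (norm_nonneg _), norm_fourfoldPair_sq,
        norm_fourfoldPair_sq]
      exact (hab h).symm)
    (fun h k => by
      simp [PiLp.inner_apply, Fintype.sum_prod_type, fourfoldPair_apply,
        LinearIsometryEquiv.piLpCongrLeft_apply, Equiv.piCongrLeft'])
  have hT (h : H) : T₁ (T₂ h) = T₂ (T₁ h) := congr($hcomm.eq h)
  have hU' (h : H) : U.symm (fourfoldPair (a ∘L T₁) b h) = fourfoldPair a (b ∘L T₂) h := by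
    rw [← hU, U.symm_apply_apply]
  refine ⟨Fourfold H, inferInstance, inferInstance, inferInstance, U, fourfoldProj,
    fourfoldPair (a ∘L T₁) b, isSelfAdjoint_fourfoldProj, isIdempotentElem_fourfoldProj,
    norm_fourfoldPair_sq _ _, fun h => ?_, fun h => ?_⟩
  · rw [fourfoldProj_fourfoldPair, one_sub_fourfoldProj_fourfoldPair, ← map_add, ← hU]
    congr 1
    ext ⟨i, j⟩
    cases i <;> simp [fourfoldPair_apply, hT]
  · rw [hU', hU', fourfoldProj_fourfoldPair, one_sub_fourfoldProj_fourfoldPair]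
    ext ⟨i, j⟩
    cases i <;> simp [fourfoldPair_apply]

end BCLTriple

section BCLAlgebra

variable {R : Type*} [Ring R] {u v p : R}

lemma BCL_coeff_zero (hvu : v * u = 1) (hp : p * p = p) : p * v * (u * (1 - p)) = 0 := by
  rw [mul_assoc, ← mul_assoc v, hvu, one_mul, mul_sub, mul_one, hp, sub_self]

lemma BCL_coeff_two (hvu : v * u = 1) (hp : p * p = p) : (1 - p) * v * (u * p) = 0 := by
  rw [mul_assoc, ← mul_assoc v, hvu, one_mul, sub_mul, one_mul, hp, sub_self]

lemma BCL_coeff_one (hvu : v * u = 1) (hp : p * p = p) :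
    p * v * (u * p) + (1 - p) * v * (u * (1 - p)) = 1 := by
  have h (a b : R) : a * v * (u * b) = a * b := by
    rw [mul_assoc, ← mul_assoc v, hvu, one_mul]
  rw [h, h, mul_sub, mul_one, sub_mul, one_mul, hp, sub_self, sub_zero, add_sub_cancel]

lemma BCL_coeff_zero' (hp : p * p = p) : u * (1 - p) * (p * v) = 0 := by
  rw [mul_assoc, ← mul_assoc (1 - p), sub_mul, one_mul, hp, sub_self, zero_mul, mul_zero]

lemma BCL_coeff_two' (hp : p * p = p) : u * p * ((1 - p) * v) = 0 := by
  rw [mul_assoc, ← mul_assoc p, mul_sub, mul_one, hp, sub_self, zero_mul, mul_zero]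

lemma BCL_coeff_one' (huv : u * v = 1) (hp : p * p = p) :
    u * (1 - p) * ((1 - p) * v) + u * p * (p * v) = 1 := by
  have h (a b : R) : u * a * (b * v) = u * (a * b) * v := by simp only [mul_assoc]
  rw [h, h, hp, mul_sub, mul_one, sub_mul, one_mul, hp, sub_self, sub_zero, ← add_mul,
    ← mul_add, sub_add_cancel, mul_one, huv]

variable [Algebra ℂ R]

lemma BCL_symbol_mul (hvu : v * u = 1) (hp : p * p = p) (z : ℂ) :
    (p + z • (1 - p)) * v * (u * ((1 - p) + z • p)) = z • 1 := by
  rw [mul_assoc, ← mul_assoc v, hvu, one_mul]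
  simp only [add_mul, mul_add, mul_sub, sub_mul, smul_mul_assoc, mul_smul_comm, mul_one, one_mul,
    hp]
  module

lemma BCL_symbol_mul' (huv : u * v = 1) (hp : p * p = p) (z : ℂ) :
    u * ((1 - p) + z • p) * ((p + z • (1 - p)) * v) = z • 1 := by
  have h : ((1 - p) + z • p) * (p + z • (1 - p)) = z • 1 := by
    simp only [add_mul, mul_add, mul_sub, sub_mul, smul_mul_assoc, mul_smul_comm, mul_one,
      one_mul, hp]
    module
  rw [mul_assoc, ← mul_assoc (1 - p + z • p), h, smul_mul_assoc, one_mul, mul_smul_comm, huv]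

end BCLAlgebra

section Intertwining

variable {H K : Type*} [NormedAddCommGroup H] [InnerProductSpace ℂ H] [CompleteSpace H]
  [NormedAddCommGroup K] [InnerProductSpace ℂ K] [CompleteSpace K]

lemma norm_adjoint_apply_le_of_isometric {M : K →L[ℂ] K} (hM : ∀ f, ‖M f‖ = ‖f‖) (f : K) :
    ‖adjoint M f‖ ≤ ‖f‖ := by
  refine (adjoint M).le_of_opNorm_le ?_ f |>.trans_eq (one_mul _)
  rw [LinearIsometryEquiv.norm_map]
  exact M.opNorm_le_bound zero_le_one fun x => by rw [hM, one_mul]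

lemma isPositive_sub_of_intertwining {S : H →L[ℂ] K} {T : H →L[ℂ] H} {M : K →L[ℂ] K}
    (hM : ∀ f, ‖M f‖ = ‖f‖) (hST : S ∘L T = adjoint M ∘L S) :
    (adjoint S ∘L S - adjoint T ∘L (adjoint S ∘L S) ∘L T).IsPositive := by
  have hadj : adjoint T ∘L (adjoint S ∘L S) ∘L T = adjoint (S ∘L T) ∘L (S ∘L T) := by
    rw [adjoint_comp]
    rfl
  rw [hadj, isPositive_def']
  refine ⟨(isPositive_adjoint_comp_self S).isSelfAdjoint.sub
    (isPositive_adjoint_comp_self (S ∘L T)).isSelfAdjoint, fun x => ?_⟩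
  have key (A : H →L[ℂ] K) : (inner ℂ ((adjoint A ∘L A) x) x).re = ‖A x‖ ^ 2 := by
    rw [ContinuousLinearMap.comp_apply, adjoint_inner_left]
    exact (norm_sq_eq_re_inner (𝕜 := ℂ) _).symm
  change 0 ≤ (inner ℂ ((adjoint S ∘L S) x - (adjoint (S ∘L T) ∘L (S ∘L T)) x) x).re
  rw [inner_sub_left, Complex.sub_re, key, key, hST, sub_nonneg]
  gcongr
  exact norm_adjoint_apply_le_of_isometric hM (S x)

lemma tendsto_conj_pow_of_intertwining {S : H →L[ℂ] K} {T : H →L[ℂ] H} {X : K →L[ℂ] K}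
    (hT : ‖T‖ ≤ 1) (hST : S ∘L T = X ∘L S)
    (hX : ∀ f, Tendsto (fun n : ℕ => (X ^ n) f) atTop (𝓝 0)) (h : H) :
    Tendsto (fun n : ℕ => ((adjoint T ^ n) ∘L (adjoint S ∘L S) ∘L (T ^ n)) h) atTop (𝓝 0) := by
  have hpow (n : ℕ) : S ((T ^ n) h) = (X ^ n) (S h) := by
    induction n with
    | zero => simp
    | succ n ih =>
      rw [pow_succ', pow_succ', mul_apply_eq_comp, mul_apply_eq_comp, ← ih]
      exact congr($hST _)
  have hT' (n : ℕ) : ‖adjoint T ^ n‖ ≤ 1 := by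
    have hT1 : ‖adjoint T‖ ≤ 1 := by rwa [LinearIsometryEquiv.norm_map]
    induction n with
    | zero => exact norm_id_le
    | succ n ih =>
      rw [pow_succ']
      exact (norm_mul_le _ _).trans (mul_le_one₀ hT1 (norm_nonneg _) ih)
  refine squeeze_zero_norm (a := fun n => ‖adjoint S‖ * ‖(X ^ n) (S h)‖) (fun n => ?_) ?_
  · simp only [ContinuousLinearMap.comp_apply, hpow]
    refine ((adjoint T ^ n).le_of_opNorm_le (hT' n) _).trans ?_
    rw [one_mul]
    exact (adjoint S).le_opNorm _
  · simpa using ((hX (S h)).norm.const_mul ‖adjoint S‖)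

lemma inner_conj_pow (N T : H →L[ℂ] H) (n : ℕ) (h : H) :
    inner ℂ (((adjoint T ^ n) ∘L N ∘L (T ^ n)) h) h = inner ℂ (N ((T ^ n) h)) ((T ^ n) h) := by
  have : adjoint T ^ n = adjoint (T ^ n) := (star_pow T n).symm
  rw [this]
  simp only [ContinuousLinearMap.comp_apply, adjoint_inner_left]

end Intertwining

/-- BCL factorization of positive pure lower `T`-Toeplitz operators for a pair
of commuting contractions: `N` is a positive pure lower `(T₁,T₂)`-Toeplitz
operator iff `N = Π* Π` and `Π Tᵢ = M_{Φᵢ}* Π` for a BCL pair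
`Φ₁(z) = (P + zP^⊥)U*`, `Φ₂(z) = U(P^⊥ + zP)`; in this case
`Φ₁(z)Φ₂(z) = Φ₂(z)Φ₁(z) = z` and `M_{Φ₁}, M_{Φ₂}` are commuting isometries. -/
theorem pure_lower_toeplitz_BCL_pair.{u}
    {H : Type u} [NormedAddCommGroup H] [InnerProductSpace ℂ H] [CompleteSpace H]
    (T₁ T₂ : H →L[ℂ] H) (hcomm : Commute T₁ T₂)
    (hc₁ : ‖T₁‖ ≤ 1) (hc₂ : ‖T₂‖ ≤ 1)
    (N : H →L[ℂ] H) (hN : N.IsPositive) :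
    ((N - adjoint T₁ ∘L N ∘L T₁).IsPositive ∧
     (N - adjoint T₂ ∘L N ∘L T₂).IsPositive ∧
     (∀ h : H, Tendsto
        (fun k : ℕ => (((adjoint (T₁ ∘L T₂)) ^ k) ∘L N ∘L ((T₁ ∘L T₂) ^ k)) h)
        atTop (𝓝 0))) ↔
    ∃ (E : Type u) (_ : NormedAddCommGroup E) (_ : InnerProductSpace ℂ E)
      (_ : CompleteSpace E)
      (Pc : H →L[ℂ] lp (fun _ : ℕ => E) 2) (U P' : E →L[ℂ] E),
      (adjoint U ∘L U = 1 ∧ U ∘L adjoint U = 1) ∧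
      (IsSelfAdjoint P' ∧ IsIdempotentElem P') ∧
      (∀ z : ℂ, ((P' + z • (1 - P')) ∘L adjoint U) ∘L (U ∘L ((1 - P') + z • P')) =
        z • (1 : E →L[ℂ] E)) ∧
      (∀ z : ℂ, (U ∘L ((1 - P') + z • P')) ∘L ((P' + z • (1 - P')) ∘L adjoint U) =
        z • (1 : E →L[ℂ] E)) ∧
      N = adjoint Pc ∘L Pc ∧
      ∃ M₁ M₂ : lp (fun _ : ℕ => E) 2 →L[ℂ] lp (fun _ : ℕ => E) 2,
        (∀ f, M₁ f 0 = (P' ∘L adjoint U) (f 0)) ∧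
        (∀ f (k : ℕ), M₁ f (k + 1) =
          (P' ∘L adjoint U) (f (k + 1)) + ((1 - P') ∘L adjoint U) (f k)) ∧
        (∀ f, M₂ f 0 = (U ∘L (1 - P')) (f 0)) ∧
        (∀ f (k : ℕ), M₂ f (k + 1) =
          (U ∘L (1 - P')) (f (k + 1)) + (U ∘L P') (f k)) ∧
        (∀ f, ‖M₁ f‖ = ‖f‖) ∧ (∀ f, ‖M₂ f‖ = ‖f‖) ∧
        M₁ ∘L M₂ = M₂ ∘L M₁ ∧
        Pc ∘L T₁ = adjoint M₁ ∘L Pc ∧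
        Pc ∘L T₂ = adjoint M₂ ∘L Pc := by
  constructor
  · rintro ⟨h₁, h₂, hlim⟩
    obtain ⟨b, hb⟩ := h₁.exists_norm_sq_eq
    obtain ⟨a, ha⟩ := h₂.exists_norm_sq_eq
    replace hb (h : H) : ‖b h‖ ^ 2 = (inner ℂ (N h) h).re - (inner ℂ (N (T₁ h)) (T₁ h)).re := by
      simp [hb, adjoint_inner_left]
    replace ha (h : H) : ‖a h‖ ^ 2 = (inner ℂ (N h) h).re - (inner ℂ (N (T₂ h)) (T₂ h)).re := by
      simp [ha, adjoint_inner_left]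
    have hT (h : H) : T₁ (T₂ h) = T₂ (T₁ h) := congr($hcomm.eq h)
    obtain ⟨E, _, _, _, U, P, G, hPsa, hPid, hG, hG₁, hG₂⟩ :=
      exists_BCL_triple T₁ T₂ a b hcomm fun h => by
        rw [ha, hb, ha, hb, hT]
        ring
    obtain ⟨S, hS, hNS⟩ := exists_factorization_of_defect (T := T₁ ∘L T₂) hN G
      (fun h => by
        rw [hG, ha, hb, ContinuousLinearMap.comp_apply, hT]
        ring)
      (fun h => by
        have : Tendsto _ _ (𝓝 (inner ℂ (0 : H) h)) := (hlim h).inner tendsto_const_nhds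
        simp only [inner_conj_pow, inner_zero_left] at this
        exact (Complex.continuous_re.tendsto 0).comp this)
    let V : E →L[ℂ] E := U
    have hV : adjoint V = (U.symm : E →L[ℂ] E) := U.adjoint_eq_symm
    have hvu : adjoint V * V = 1 := by
      rw [hV]; ext x; exact U.symm_apply_apply x
    have huv : V * adjoint V = 1 := by
      rw [hV]; ext x; exact U.apply_symm_apply x
    have hPP : P * P = P := hPid
    have hPadj : adjoint P = P := hPsa
    have hQadj : adjoint (1 - P) = 1 - P := (IsSelfAdjoint.one _).sub hPsa
    have horth (x y : E) : inner ℂ (P x) ((1 - P) y) = 0 := by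
      rw [← hPadj, adjoint_inner_left, ← mul_apply_eq_comp, hPadj, mul_sub, mul_one, hPP]
      simp
    have hpyth (x : E) : ‖P x‖ ^ 2 + ‖(1 - P) x‖ ^ 2 = ‖x‖ ^ 2 := by
      have := norm_add_sq_eq_norm_sq_add_norm_sq_of_inner_eq_zero _ _ (horth x x)
      have hx : P x + (1 - P) x = x := add_sub_cancel _ _
      rw [hx] at this
      simpa only [sq] using this.symm
    obtain ⟨M₁, hM₁, hM₁n⟩ := exists_isometric_hasLinearSymbol (P ∘L adjoint V)
      ((1 - P) ∘L adjoint V) (fun x y => horth _ _) fun x => by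
        rw [ContinuousLinearMap.comp_apply, ContinuousLinearMap.comp_apply, hpyth, hV]
        exact congr($(U.symm.norm_map x) ^ 2)
    obtain ⟨M₂, hM₂, hM₂n⟩ := exists_isometric_hasLinearSymbol (V ∘L (1 - P)) (V ∘L P)
      (fun x y => (U.inner_map_map _ _).trans (inner_eq_zero_symm.1 (horth y x))) fun x => by
        rw [ContinuousLinearMap.comp_apply, ContinuousLinearMap.comp_apply]
        rw [← hpyth x, add_comm]
        exact congr($(U.norm_map _) ^ 2 + $(U.norm_map _) ^ 2)
    have h₁₂ := hM₁.comp_eq_shift hM₂ (BCL_coeff_zero hvu hPP) (BCL_coeff_two hvu hPP)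
      (BCL_coeff_one hvu hPP)
    have h₂₁ := hM₂.comp_eq_shift hM₁ (BCL_coeff_zero' hPP) (BCL_coeff_two' hPP)
      (BCL_coeff_one' huv hPP)
    have hSsucc (h : H) (k : ℕ) : S h (k + 1) = G (T₁ (T₂ (((T₁ ∘L T₂) ^ k) h))) := by
      rw [hS, pow_succ']
      rfl
    have hc₁ (k : ℕ) (h : H) : ((T₁ ∘L T₂) ^ k) (T₁ h) = T₁ (((T₁ ∘L T₂) ^ k) h) :=
      congr($((((Commute.refl T₁).mul_left hcomm.symm).pow_left k).eq) h)
    have hc₂ (k : ℕ) (h : H) : ((T₁ ∘L T₂) ^ k) (T₂ h) = T₂ (((T₁ ∘L T₂) ^ k) h) :=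
      congr($(((hcomm.mul_left (Commute.refl T₂)).pow_left k).eq) h)
    refine ⟨E, inferInstance, inferInstance, inferInstance, S, V, P, ⟨hvu, huv⟩, ⟨hPsa, hPid⟩,
      BCL_symbol_mul hvu hPP, BCL_symbol_mul' huv hPP, hNS, M₁, M₂, hM₁.apply_zero,
      hM₁.apply_succ, hM₂.apply_zero, hM₂.apply_succ, hM₁n, hM₂n, h₁₂.ext h₂₁, ?_, ?_⟩
    · ext h k
      rw [ContinuousLinearMap.comp_apply, ContinuousLinearMap.comp_apply, hM₁.adjoint_apply,
        hSsucc, hS, hS, hc₁, hG₁, adjoint_comp, adjoint_comp, adjoint_adjoint, hPadj, hQadj]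
      rfl
    · ext h k
      rw [ContinuousLinearMap.comp_apply, ContinuousLinearMap.comp_apply, hM₂.adjoint_apply,
        hSsucc, hS, hS, hc₂, hG₂, adjoint_comp, adjoint_comp, hPadj, hQadj, hV]
      rfl
  · rintro ⟨E, _, _, _, S, U, P, ⟨hvu, huv⟩, ⟨-, hP⟩, -, -, rfl, M₁, M₂, h₁z, h₁s, h₂z, h₂s,
      hM₁n, hM₂n, hM, hS₁, hS₂⟩
    have h₂₁ := HasLinearSymbol.comp_eq_shift ⟨h₂z, h₂s⟩ ⟨h₁z, h₁s⟩ (BCL_coeff_zero' hP)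
      (BCL_coeff_two' hP) (BCL_coeff_one' huv hP)
    refine ⟨isPositive_sub_of_intertwining hM₁n hS₁, isPositive_sub_of_intertwining hM₂n hS₂,
      tendsto_conj_pow_of_intertwining (X := adjoint (M₂ ∘L M₁)) ?_ ?_ h₂₁.tendsto_adjoint_pow⟩
    · exact (norm_mul_le T₁ T₂).trans (mul_le_one₀ hc₁ (norm_nonneg _) hc₂)
    · rw [← ContinuousLinearMap.comp_assoc, hS₁, ContinuousLinearMap.comp_assoc, hS₂, adjoint_comp]
      rfl
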